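/- arXiv:1711.00978 — 2 statements merged into one kernel-verified Lean document; each statement's English description precedes it below -/
import Mathlib

section
/- For every t > 0, the image T₂(t)(C_b) = {T₂(t)φ : φ ∈ C_b} has compact closure in C(ℝ,ℝ) equipped with the compact-open topology (the topology of uniform convergence on compact sets); that is, the operator T₂(t) is compact on C_b with respect to the compact-open topology. -/
open MeasureTheory Real Set

/-- Iterated convolutions: `a_0(φ) = φ`, `a_k(φ)(x) = ∫ J(x−y) a_{k−1}(φ)(y) dy`. -/
noncomputable def ak (J : ℝ → ℝ) : ℕ → (ℝ → ℝ) → ℝ → ℝ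
  | 0, φ => φ
  | k + 1, φ => fun x => ∫ y, J (x - y) * ak J k φ y

/-- `T₂(t)φ(x) = e^{−t} Σ_{k=1}^∞ (t^k/k!) a_k(φ)(x)` (indexed by `k+1` for `k : ℕ`). -/
noncomputable def T2map (J : ℝ → ℝ) (t : ℝ) (φ : ℝ → ℝ) (x : ℝ) : ℝ :=
  Real.exp (-t) * ∑' k : ℕ, t ^ (k + 1) / (Nat.factorial (k + 1)) * ak J (k + 1) φ x

open Filter Topology

theorem sub_integrable_aux {J : ℝ → ℝ} (hJi : Integrable J) (x : ℝ) :
    Integrable (fun y => J (x - y)) := hJi.comp_sub_left x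

theorem omega_tendsto {J : ℝ → ℝ} (hJi : Integrable J) (x₀ : ℝ) :
    Tendsto (fun x => ∫ y, |J (x₀ - y) - J (x - y)|) (𝓝 x₀) (𝓝 0) := by
  have hm : MemLp J 1 volume := memLp_one_iff_integrable.2 hJi
  let g : ℝ → C(ℝ, ℝ) :=
    (ContinuousMap.mk (fun a : ℝ × ℝ => a.1 - a.2) (by fun_prop)).curry
  have hg : Continuous g := ContinuousMap.continuous _
  have hgm : ∀ z, MeasurePreserving (g z) volume volume := fun z =>
    Measure.measurePreserving_sub_left volume z
  have hc := (continuous_const (y := hm.toLp J)).compMeasurePreservingLp hg hgm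
    ENNReal.one_ne_top
  have h1 : Tendsto (fun x => dist (Lp.compMeasurePreserving (g x₀) (hgm x₀) (hm.toLp J))
      (Lp.compMeasurePreserving (g x) (hgm x) (hm.toLp J))) (𝓝 x₀) (𝓝 0) := by
    have := (continuous_const (y := Lp.compMeasurePreserving (g x₀) (hgm x₀) (hm.toLp J))).dist hc
    have h2 := this.tendsto x₀
    rwa [dist_self] at h2
  refine h1.congr fun x => ?_
  rw [Lp.toLp_compMeasurePreserving, Lp.toLp_compMeasurePreserving, dist_edist,
    Lp.edist_toLp_toLp, eLpNorm_one_eq_lintegral_enorm, ← integral_norm_eq_lintegral_enorm]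
  · rfl
  · exact ((sub_integrable_aux hJi x₀).sub (sub_integrable_aux hJi x)).aestronglyMeasurable

theorem conv_integrable {J : ℝ → ℝ} (hJi : Integrable J) {b : ℝ} {f : ℝ → ℝ}
    (hf : Continuous f) (hfb : ∀ x, f x ∈ Set.Icc 0 b) (x : ℝ) :
    Integrable (fun y => J (x - y) * f y) := by
  refine (sub_integrable_aux hJi x).mul_bdd (c := b) hf.aestronglyMeasurable ?_
  refine Eventually.of_forall fun y => ?_
  rw [Real.norm_of_nonneg (hfb y).1]
  exact (hfb y).2

theorem conv_dist {J : ℝ → ℝ} (hJi : Integrable J) {b : ℝ} {f : ℝ → ℝ}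
    (hf : Continuous f) (hfb : ∀ x, f x ∈ Set.Icc 0 b) (x₀ x : ℝ) :
    dist (∫ y, J (x₀ - y) * f y) (∫ y, J (x - y) * f y) ≤
      b * ∫ y, |J (x₀ - y) - J (x - y)| := by
  rw [Real.dist_eq, ← integral_sub (conv_integrable hJi hf hfb x₀) (conv_integrable hJi hf hfb x),
    ← Real.norm_eq_abs, ← integral_const_mul]
  refine norm_integral_le_of_norm_le
    (((sub_integrable_aux hJi x₀).sub (sub_integrable_aux hJi x)).abs.const_mul b) ?_
  refine Eventually.of_forall fun y => ?_
  have : J (x₀ - y) * f y - J (x - y) * f y = f y * (J (x₀ - y) - J (x - y)) := by ring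
  rw [this, norm_mul, Real.norm_of_nonneg (hfb y).1, Real.norm_eq_abs]
  exact mul_le_mul_of_nonneg_right (hfb y).2 (abs_nonneg _)

theorem conv_cont {J : ℝ → ℝ} (hJi : Integrable J) {b : ℝ} {f : ℝ → ℝ}
    (hf : Continuous f) (hfb : ∀ x, f x ∈ Set.Icc 0 b) :
    Continuous (fun x => ∫ y, J (x - y) * f y) := by
  rw [continuous_iff_continuousAt]
  intro x₀
  rw [ContinuousAt, tendsto_iff_dist_tendsto_zero]
  have h := (omega_tendsto hJi x₀).const_mul b
  rw [mul_zero] at h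
  refine squeeze_zero (fun _ => dist_nonneg) (fun x => ?_) h
  rw [dist_comm]
  exact conv_dist hJi hf hfb x₀ x

theorem conv_mem {J : ℝ → ℝ} (hJ0 : ∀ y, 0 ≤ J y) (hJi : Integrable J)
    (hJ1 : ∫ y, J y = 1) {b : ℝ} {f : ℝ → ℝ}
    (hf : Continuous f) (hfb : ∀ x, f x ∈ Set.Icc 0 b) (x : ℝ) :
    (∫ y, J (x - y) * f y) ∈ Set.Icc 0 b := by
  constructor
  · exact integral_nonneg fun y => mul_nonneg (hJ0 _) (hfb y).1
  · calc (∫ y, J (x - y) * f y) ≤ ∫ y, J (x - y) * b :=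
          integral_mono (conv_integrable hJi hf hfb x) ((sub_integrable_aux hJi x).mul_const b)
            fun y => mul_le_mul_of_nonneg_left (hfb y).2 (hJ0 _)
      _ = b := by
          rw [integral_mul_const, integral_sub_left_eq_self J volume x, hJ1, one_mul]

theorem ak_good {J : ℝ → ℝ} (hJ0 : ∀ y, 0 ≤ J y) (hJi : Integrable J)
    (hJ1 : ∫ y, J y = 1) {b : ℝ} {f : ℝ → ℝ}
    (hf : Continuous f) (hfb : ∀ x, f x ∈ Set.Icc 0 b) (k : ℕ) :
    Continuous (ak J k f) ∧ ∀ x, ak J k f x ∈ Set.Icc 0 b := by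
  induction k with
  | zero => exact ⟨hf, hfb⟩
  | succ k ih => exact ⟨conv_cont hJi ih.1 ih.2, conv_mem hJ0 hJi hJ1 ih.1 ih.2⟩

theorem coef_summable (t : ℝ) :
    Summable (fun k : ℕ => t ^ (k + 1) / (Nat.factorial (k + 1) : ℝ)) :=
  (summable_nat_add_iff 1).2 (Real.summable_pow_div_factorial t)

theorem T2_dist {J : ℝ → ℝ} (hJ0 : ∀ y, 0 ≤ J y) (hJi : Integrable J)
    (hJ1 : ∫ y, J y = 1) {b : ℝ} {f : ℝ → ℝ}
    (hf : Continuous f) (hfb : ∀ x, f x ∈ Set.Icc 0 b) {t : ℝ} (ht : 0 < t) (x₀ x : ℝ) :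
    dist (T2map J t f x₀) (T2map J t f x) ≤
      Real.exp (-t) * ((∑' k : ℕ, t ^ (k + 1) / (Nat.factorial (k + 1) : ℝ)) *
        (b * ∫ y, |J (x₀ - y) - J (x - y)|)) := by
  have hs : ∀ x, Summable (fun k : ℕ => t ^ (k + 1) / (Nat.factorial (k + 1) : ℝ) *
      ak J (k + 1) f x) := fun x =>
    Summable.of_nonneg_of_le
      (fun k => mul_nonneg (by positivity) ((ak_good hJ0 hJi hJ1 hf hfb (k + 1)).2 x).1)
      (fun k => mul_le_mul_of_nonneg_left ((ak_good hJ0 hJi hJ1 hf hfb (k + 1)).2 x).2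
        (by positivity)) ((coef_summable t).mul_right b)
  rw [T2map, T2map, Real.dist_eq, ← mul_sub, abs_mul, abs_of_pos (Real.exp_pos _),
    ← (hs x₀).tsum_sub (hs x), ← tsum_mul_right, ← Real.norm_eq_abs]
  refine mul_le_mul_of_nonneg_left ?_ (Real.exp_pos _).le
  refine tsum_of_norm_bounded ((coef_summable t).mul_right _).hasSum fun k => ?_
  rw [← mul_sub, norm_mul, Real.norm_of_nonneg (by positivity)]
  refine mul_le_mul_of_nonneg_left ?_ (by positivity)
  have hk := ak_good hJ0 hJi hJ1 hf hfb k
  exact conv_dist hJi hk.1 hk.2 x₀ x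

theorem T2_norm {J : ℝ → ℝ} (hJ0 : ∀ y, 0 ≤ J y) (hJi : Integrable J)
    (hJ1 : ∫ y, J y = 1) {b : ℝ} {f : ℝ → ℝ}
    (hf : Continuous f) (hfb : ∀ x, f x ∈ Set.Icc 0 b) {t : ℝ} (ht : 0 < t) (x : ℝ) :
    ‖T2map J t f x‖ ≤
      Real.exp (-t) * ((∑' k : ℕ, t ^ (k + 1) / (Nat.factorial (k + 1) : ℝ)) * b) := by
  rw [T2map, norm_mul, Real.norm_of_nonneg (Real.exp_pos _).le, ← tsum_mul_right]
  refine mul_le_mul_of_nonneg_left ?_ (Real.exp_pos _).le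
  refine tsum_of_norm_bounded ((coef_summable t).mul_right _).hasSum fun k => ?_
  have hk := (ak_good hJ0 hJi hJ1 hf hfb (k + 1)).2 x
  rw [norm_mul, Real.norm_of_nonneg (by positivity), Real.norm_of_nonneg hk.1]
  exact mul_le_mul_of_nonneg_left hk.2 (by positivity)

/-- for every `t > 0`, the image `T₂(t)(C_b)` has compact closure in
`C(ℝ, ℝ)` with the compact-open topology; i.e. `T₂(t)` is a compact operator on
`C_b` with respect to the compact-open topology. -/
theorem stmt_8 (J : ℝ → ℝ) (hJ0 : ∀ y, 0 ≤ J y) (hJi : Integrable J)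
    (hJ1 : ∫ y, J y = 1) (b : ℝ) (hb : 0 < b)
    (t : ℝ) (ht : 0 < t) :
    IsCompact (closure {ψ : C(ℝ, ℝ) | ∃ φ : C(ℝ, ℝ),
      (∀ x, φ x ∈ Set.Icc 0 b) ∧ ∀ x, ψ x = T2map J t (⇑φ) x}) := by
  haveI : T2Space (UniformOnFun ℝ ℝ {K : Set ℝ | IsCompact K}) :=
    UniformOnFun.t2Space_of_covering
      (eq_univ_iff_forall.mpr (fun x => mem_sUnion_of_mem (mem_singleton x) isCompact_singleton))
  refine ArzelaAscoli.isCompact_closure_of_isClosedEmbedding (𝔖 := {K : Set ℝ | IsCompact K})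
    (F := fun f : C(ℝ, ℝ) => (f : ℝ → ℝ)) (fun K hK => hK)
    ContinuousMap.isUniformEmbedding_toUniformOnFunIsCompact.isClosedEmbedding ?_ ?_
  · intro K _
    refine Equicontinuous.equicontinuousOn (fun x₀ => ?_) K
    refine Metric.equicontinuousAt_of_continuity_modulus
      (fun x => Real.exp (-t) * ((∑' k : ℕ, t ^ (k + 1) / (Nat.factorial (k + 1) : ℝ)) *
        (b * ∫ y, |J (x₀ - y) - J (x - y)|))) ?_ _ ?_
    · have h := (((omega_tendsto hJi x₀).const_mul b).const_mul
        (∑' k : ℕ, t ^ (k + 1) / (Nat.factorial (k + 1) : ℝ))).const_mul (Real.exp (-t))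
      simpa only [mul_zero] using h
    · refine Eventually.of_forall fun x => ?_
      rintro ⟨ψ, φ, hφ, hψ⟩
      have := T2_dist hJ0 hJi hJ1 φ.continuous hφ ht x₀ x
      rw [← hψ, ← hψ] at this
      exact this
  · intro K _ x _
    refine ⟨Metric.closedBall 0
      (Real.exp (-t) * ((∑' k : ℕ, t ^ (k + 1) / (Nat.factorial (k + 1) : ℝ)) * b)),
      isCompact_closedBall _ _, ?_⟩
    rintro ψ ⟨φ, hφ, hψ⟩
    rw [mem_closedBall_zero_iff]
    have := T2_norm hJ0 hJi hJ1 φ.continuous hφ ht x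
    rw [← hψ] at this
    exact this
end

section
/- (Theorem 1) Assume f(x,0) = 0 for all x, f(x+L,u) = f(x,u) for some L > 0, β is a positive continuous L-periodic steady state (i.e., (J∗β)(x) − β(x) + f(x,β(x)) = 0 for all x), and |f(x,u₁) − f(x,u₂)| ≤ k_f |u₁ − u₂| for all x ∈ [0,L] and u₁,u₂ ∈ [0,β(x)], where k_f > 0. Let Q : [0,∞) × C_β → C_β be a family of maps such that for each φ ∈ C_β the map s ↦ Q(s)φ is continuous from [0,∞) to C_β with respect to the supremum norm, and Q satisfies the variation-of-constants formula Q(t)φ = T(t)φ + ∫_0^t T(t−s) f̂(Q(s)φ) ds for all t > 0, where f̂(ψ)(x) = f(x,ψ(x)). Then for any nonempty bounded interval I = [a,b'] ⊂ ℝ, any t ≥ 0, and any subset B of C_β, one has α((Q(t)B)_I) ≤ e^{(k_f − 1)t} α(B_I), where α is the Kuratowski measure of noncompactness in the Banach space C(I,ℝ) with the supremum norm. -/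
open MeasureTheory Real Set
open scoped ENNReal

/-- The linear solution map `T(t)φ(x) = e^{−t} Σ_{k=0}^∞ (t^k/k!) a_k(φ)(x)`. -/
noncomputable def Tmap (J : ℝ → ℝ) (t : ℝ) (φ : ℝ → ℝ) (x : ℝ) : ℝ :=
  Real.exp (-t) * ∑' k : ℕ, t ^ k / (Nat.factorial k) * ak J k φ x

/-- The Kuratowski measure of noncompactness: the infimum (in `ℝ≥0∞`, so `∞` if no
such cover exists) of all `ε` such that `A` admits a finite cover by sets of
diameter at most `ε`. -/
noncomputable def kurat {X : Type*} [PseudoEMetricSpace X] (A : Set X) : ℝ≥0∞ :=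
  sInf {ε : ℝ≥0∞ | ∃ (n : ℕ) (C : Fin n → Set X), A ⊆ ⋃ i, C i ∧
    ∀ i, EMetric.diam (C i) ≤ ε}

/-- The restrictions to `[a,b']` of the members of a set `V` of functions on `ℝ`,
regarded as a subset of the Banach space `C([a,b'], ℝ)` with the sup norm. -/
def restrictSet (a b' : ℝ) (V : Set (ℝ → ℝ)) : Set C(Set.Icc a b', ℝ) :=
  {ψ | ∃ φ ∈ V, ∀ x : Set.Icc a b', ψ x = φ ↑x}

/-- Membership of `C_β`: continuous functions `φ : ℝ → ℝ` with `0 ≤ φ(x) ≤ β(x)`. -/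
def memCbeta (β : ℝ → ℝ) (φ : ℝ → ℝ) : Prop :=
  Continuous φ ∧ ∀ x, φ x ∈ Set.Icc 0 (β x)

open Filter Topology

noncomputable def om (J : ℝ → ℝ) (x x0 : ℝ) : ℝ := ∫ z, |J (x - z) - J (x0 - z)|

lemma om_tendsto {J : ℝ → ℝ} (hJi : Integrable J) (x0 : ℝ) :
    Tendsto (fun x => om J x x0) (𝓝 x0) (𝓝 0) := by
  have : Fact ((1 : ℝ≥0∞) ≤ 1) := ⟨le_refl _⟩
  have hmp : ∀ x : ℝ, MeasurePreserving (fun z : ℝ => x - z) volume volume := fun x =>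
    Measure.measurePreserving_sub_left volume x
  let g : C(ℝ, C(ℝ, ℝ)) :=
    (ContinuousMap.mk (fun a : ℝ × ℝ ↦ a.1 - a.2) (by fun_prop)).curry
  have hc : Continuous (fun x : ℝ =>
      Lp.compMeasurePreserving (g x) (hmp x) (hJi.toL1 J)) :=
    (continuous_const (y := hJi.toL1 J)).compMeasurePreservingLp g.continuous hmp (by simp)
  have h1 := (tendsto_iff_dist_tendsto_zero.1 (hc.tendsto x0))
  refine h1.congr fun x => ?_
  rw [dist_eq_norm, L1.norm_eq_integral_norm]
  refine integral_congr_ae ?_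
  have e : ∀ x, Lp.compMeasurePreserving (g x) (hmp x) (hJi.toL1 J)
      =ᵐ[volume] fun z => J (x - z) := by
    intro x
    refine (Lp.coeFn_compMeasurePreserving _ (hmp x)).trans ?_
    exact (hmp x).quasiMeasurePreserving.ae_eq_comp hJi.coeFn_toL1
  filter_upwards [Lp.coeFn_sub (Lp.compMeasurePreserving (g x) (hmp x) (hJi.toL1 J))
    (Lp.compMeasurePreserving (g x0) (hmp x0) (hJi.toL1 J)), e x, e x0] with z h1 h2 h3
  rw [h1, Pi.sub_apply, h2, h3, Real.norm_eq_abs]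

lemma om_nonneg (J : ℝ → ℝ) (x x0 : ℝ) : 0 ≤ om J x x0 :=
  integral_nonneg fun _ => abs_nonneg _

section
variable {J : ℝ → ℝ} (hJ0 : ∀ y, 0 ≤ J y) (hJi : Integrable J) (hJ1 : ∫ y, J y = 1)
include hJ0 hJi hJ1

lemma conv_bound {h : ℝ → ℝ} {M : ℝ} (hM : ∀ y, |h y| ≤ M) (x : ℝ) :
    |∫ y, J (x - y) * h y| ≤ M := by
  have := norm_integral_le_of_norm_le (f := fun y => J (x - y) * h y)
    (g := fun y => J (x - y) * M) (μ := volume) ((hJi.comp_sub_left x).mul_const M)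
    (Eventually.of_forall fun y => by
      rw [norm_mul, Real.norm_eq_abs, Real.norm_eq_abs, abs_of_nonneg (hJ0 _)]
      exact mul_le_mul_of_nonneg_left (hM y) (hJ0 _))
  rw [integral_mul_const, integral_sub_left_eq_self (fun y => J y) volume x, hJ1, one_mul] at this
  exact this

lemma ak_bound {h : ℝ → ℝ} {M : ℝ} (hM : ∀ y, |h y| ≤ M) (k : ℕ) :
    ∀ x, |ak J k h x| ≤ M := by
  induction k with
  | zero => exact hM
  | succ k ih => exact fun x => conv_bound hJ0 hJi hJ1 ih x

/-- the key two-parameter estimate -/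
lemma conv_diff {h h' : ℝ → ℝ} {M e : ℝ} (hM : ∀ y, |h y| ≤ M) (hM' : ∀ y, |h' y| ≤ M)
    (x x0 : ℝ)
    (hm : AEStronglyMeasurable (fun y => J (x - y) * h y) volume)
    (hm' : AEStronglyMeasurable (fun y => J (x0 - y) * h' y) volume)
    (he : ∀ y, |h y - h' y| ≤ e) :
    |(∫ y, J (x - y) * h y) - ∫ y, J (x0 - y) * h' y| ≤ M * om J x x0 + e := by
  have hI : ∀ (x : ℝ) (h : ℝ → ℝ), (∀ y, |h y| ≤ M) →
      AEStronglyMeasurable (fun y => J (x - y) * h y) volume →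
      Integrable (fun y => J (x - y) * h y) := by
    intro x h hM hm
    refine ((hJi.comp_sub_left x).mul_const M).mono' hm (Eventually.of_forall fun y => ?_)
    rw [norm_mul, Real.norm_eq_abs, Real.norm_eq_abs, abs_of_nonneg (hJ0 _)]
    exact mul_le_mul_of_nonneg_left (hM y) (hJ0 _)
  have hd : Integrable (fun z => |J (x - z) - J (x0 - z)|) :=
    ((hJi.comp_sub_left x).sub (hJi.comp_sub_left x0)).abs
  rw [← integral_sub (hI x h hM hm) (hI x0 h' hM' hm')]
  have := norm_integral_le_of_norm_le (f := fun y => J (x - y) * h y - J (x0 - y) * h' y)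
    (g := fun y => M * |J (x - y) - J (x0 - y)| + J (x0 - y) * e) (μ := volume)
    ((hd.const_mul M).add ((hJi.comp_sub_left x0).mul_const e))
    (Eventually.of_forall fun y => by
      rw [Real.norm_eq_abs]
      have : J (x - y) * h y - J (x0 - y) * h' y
        = h y * (J (x - y) - J (x0 - y)) + J (x0 - y) * (h y - h' y) := by ring
      rw [this]
      refine (abs_add_le _ _).trans (add_le_add ?_ ?_)
      · rw [abs_mul]; exact mul_le_mul_of_nonneg_right (hM y) (abs_nonneg _)
      · rw [abs_mul, abs_of_nonneg (hJ0 _)]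
        exact mul_le_mul_of_nonneg_left (he y) (hJ0 _))
  rw [integral_add (hd.const_mul M) ((hJi.comp_sub_left x0).mul_const e), integral_const_mul,
    integral_mul_const, integral_sub_left_eq_self (fun y => J y) volume x0, hJ1, one_mul] at this
  exact this

lemma Jmul_aesm {h : ℝ → ℝ} (hh : AEStronglyMeasurable h volume) (x : ℝ) :
    AEStronglyMeasurable (fun y => J (x - y) * h y) volume :=
  (hJi.comp_sub_left x).aestronglyMeasurable.mul hh

lemma ak_cont {h : ℝ → ℝ} {M : ℝ} (hM : ∀ y, |h y| ≤ M) (hc : Continuous h) (k : ℕ) :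
    Continuous (ak J k h) := by
  induction k with
  | zero => exact hc
  | succ k ih =>
    rw [continuous_iff_continuousAt]
    intro x0
    refine tendsto_iff_dist_tendsto_zero.2 ?_
    have h0 : Tendsto (fun x => M * om J x x0) (𝓝 x0) (𝓝 0) := by
      simpa using (om_tendsto hJi x0).const_mul M
    refine squeeze_zero (fun _ => dist_nonneg) (fun x => ?_) h0
    have := conv_diff hJ0 hJi hJ1 (e := 0) (ak_bound hJ0 hJi hJ1 hM k)
      (ak_bound hJ0 hJi hJ1 hM k) x x0
      (Jmul_aesm hJ0 hJi hJ1 ih.aestronglyMeasurable x)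
      (Jmul_aesm hJ0 hJi hJ1 ih.aestronglyMeasurable x0) (by simp)
    rw [add_zero] at this
    exact this

lemma ak_diff {h : ℝ → ℝ} {M : ℝ} (hM : ∀ y, |h y| ≤ M) (hc : Continuous h) (k : ℕ) (x x0 : ℝ) :
    |ak J (k+1) h x - ak J (k+1) h x0| ≤ M * om J x x0 := by
  have ih := ak_cont hJ0 hJi hJ1 hM hc k
  have := conv_diff hJ0 hJi hJ1 (e := 0) (ak_bound hJ0 hJi hJ1 hM k)
      (ak_bound hJ0 hJi hJ1 hM k) x x0
      (Jmul_aesm hJ0 hJi hJ1 ih.aestronglyMeasurable x)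
      (Jmul_aesm hJ0 hJi hJ1 ih.aestronglyMeasurable x0) (by simp)
  rw [add_zero] at this
  exact this

/-- joint measurability of the first convolution, without measurability of `g s`. -/
lemma ak_one_meas {g : ℝ → ℝ → ℝ} {M : ℝ} (hM : ∀ s y, |g s y| ≤ M)
    (hg : ∀ s0, ∀ ε > 0, ∀ᶠ s in 𝓝 s0, ∀ y, |g s y - g s0 y| ≤ ε) :
    Measurable (fun p : ℝ × ℝ => ak J 1 (g p.1) p.2) := by
  classical
  let E : Set (ℝ × ℝ) :=
    {p | AEStronglyMeasurable (fun y => J (p.2 - y) * g p.1 y) volume}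
  have hE : IsClosed E := by
    refine IsSeqClosed.isClosed ?_
    intro p q hp hpq
    have h2 : Tendsto (fun n => (p n).2) atTop (𝓝 q.2) :=
      (continuous_snd.tendsto q).comp hpq
    have h1 : Tendsto (fun n => (p n).1) atTop (𝓝 q.1) :=
      (continuous_fst.tendsto q).comp hpq
    have hom := (om_tendsto hJi q.2).comp h2
    have hL : Tendsto (fun n => eLpNorm ((fun z => J ((p n).2 - z)) - fun z => J (q.2 - z)) 1 volume)
        atTop (𝓝 0) := by
      have := (ENNReal.continuous_ofReal.tendsto 0).comp hom
      rw [ENNReal.ofReal_zero] at this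
      refine this.congr fun n => ?_
      rw [eLpNorm_one_eq_lintegral_enorm,
        ← ofReal_integral_norm_eq_lintegral_enorm ((hJi.comp_sub_left _).sub (hJi.comp_sub_left _))]
      rfl
    have hme := tendstoInMeasure_of_tendsto_eLpNorm (one_ne_zero)
      (fun n => (hJi.comp_sub_left (p n).2).aestronglyMeasurable)
      (hJi.comp_sub_left q.2).aestronglyMeasurable hL
    obtain ⟨ns, hns, hae⟩ := hme.exists_seq_tendsto_ae
    refine aestronglyMeasurable_of_tendsto_ae atTop (fun n => hp (ns n)) ?_
    filter_upwards [hae] with z hz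
    refine hz.mul ?_
    have : Tendsto (fun s => g s z) (𝓝 q.1) (𝓝 (g q.1 z)) := by
      rw [Metric.tendsto_nhds]
      intro ε hε
      filter_upwards [hg q.1 (ε/2) (by positivity)] with s hs
      rw [Real.dist_eq]
      linarith [hs z]
    exact this.comp (h1.comp hns.tendsto_atTop)
  have hcont : ContinuousOn (fun p : ℝ × ℝ => ak J 1 (g p.1) p.2) E := by
    intro q hq
    rw [ContinuousWithinAt, Metric.tendsto_nhds]
    intro ε hε
    have h0 : Tendsto (fun p : ℝ × ℝ => M * om J p.2 q.2) (𝓝 q) (𝓝 0) := by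
      simpa using ((om_tendsto hJi q.2).comp (continuous_snd.tendsto q)).const_mul M
    have a1 := nhdsWithin_le_nhds (s := E) (h0.eventually (gt_mem_nhds (show (0:ℝ) < ε/2 by positivity)))
    have a2 := nhdsWithin_le_nhds (s := E)
      ((continuous_fst.tendsto q).eventually (hg q.1 (ε/2) (by positivity)))
    filter_upwards [a1, a2, self_mem_nhdsWithin] with p h1 h2 h3
    have := conv_diff hJ0 hJi hJ1 (hM p.1) (hM q.1) p.2 q.2 h3 hq h2
    rw [Real.dist_eq]
    refine lt_of_le_of_lt this ?_
    have h1 : M * om J p.2 q.2 < ε / 2 := h1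
    linarith
  have key : (fun p : ℝ × ℝ => ak J 1 (g p.1) p.2)
      = E.piecewise (fun p : ℝ × ℝ => ak J 1 (g p.1) p.2) (fun _ => 0) := by
    funext p
    by_cases hp : p ∈ E
    · rw [Set.piecewise_eq_of_mem _ _ _ hp]
    · rw [Set.piecewise_eq_of_notMem _ _ _ hp]
      exact integral_non_aestronglyMeasurable hp
  rw [key]
  exact ContinuousOn.measurable_piecewise hcont continuousOn_const hE.measurableSet

lemma ak_meas {g : ℝ → ℝ → ℝ} {M : ℝ} (hM : ∀ s y, |g s y| ≤ M)
    (hg : ∀ s0, ∀ ε > 0, ∀ᶠ s in 𝓝 s0, ∀ y, |g s y - g s0 y| ≤ ε) (k : ℕ) :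
    Measurable (fun p : ℝ × ℝ => ak J (k+1) (g p.1) p.2) := by
  induction k with
  | zero => exact ak_one_meas hJ0 hJi hJ1 hM hg
  | succ k ih =>
    let J' := hJi.1.mk J
    have hJ' : Measurable J' := hJi.1.stronglyMeasurable_mk.measurable
    have e : (fun p : ℝ × ℝ => ak J (k+1+1) (g p.1) p.2)
        = fun p : ℝ × ℝ => ∫ y, J' (p.2 - y) * ak J (k+1) (g p.1) y := by
      funext p
      refine integral_congr_ae ?_
      have := (Measure.measurePreserving_sub_left (volume : Measure ℝ) p.2).quasiMeasurePreserving.ae_eq_comp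
        hJi.1.ae_eq_mk
      filter_upwards [this] with y hy
      simp only [Function.comp] at hy
      rw [hy]
    rw [e]
    have hm : Measurable (fun q : (ℝ × ℝ) × ℝ => J' (q.1.2 - q.2) * ak J (k+1) (g q.1.1) q.2) := by
      refine (hJ'.comp (by fun_prop)).mul ?_
      exact ih.comp (f := fun q : (ℝ × ℝ) × ℝ => (q.1.1, q.2)) (by fun_prop)
    exact (hm.stronglyMeasurable.integral_prod_right' (ν := (volume : Measure ℝ))).measurable

end

noncomputable def Eser (τ : ℝ) (c : ℕ → ℝ) : ℝ :=
  ∑' k : ℕ, τ ^ (k+1) / (Nat.factorial (k+1)) * c k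

lemma hasSum_exp_sub (τ : ℝ) :
    HasSum (fun k : ℕ => τ ^ (k+1) / (Nat.factorial (k+1) : ℝ)) (Real.exp τ - 1) := by
  have h : HasSum (fun k : ℕ => τ ^ k / (Nat.factorial k : ℝ)) (Real.exp τ) := by
    rw [Real.exp_eq_exp_ℝ]; exact NormedSpace.expSeries_div_hasSum_exp τ
  have := (hasSum_nat_add_iff' 1).2 h
  simpa using this

lemma Eser_summable (τ : ℝ) {c : ℕ → ℝ} {M : ℝ} (hc : ∀ k, |c k| ≤ M) :
    Summable (fun k : ℕ => τ ^ (k+1) / (Nat.factorial (k+1) : ℝ) * c k) := by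
  refine Summable.of_norm_bounded ((hasSum_exp_sub |τ|).summable.mul_right M) fun k => ?_
  rw [norm_mul, norm_div, norm_pow, Real.norm_eq_abs, Real.norm_eq_abs, Real.norm_eq_abs,
    Nat.abs_cast]
  exact mul_le_mul_of_nonneg_left (hc k) (by positivity)

lemma Eser_zero (c : ℕ → ℝ) : Eser 0 c = 0 := by simp [Eser]

lemma Eser_sub_le {τ τ' : ℝ} (h0 : 0 ≤ τ') (h : τ' ≤ τ) {c : ℕ → ℝ} {M : ℝ}
    (hc : ∀ k, |c k| ≤ M) : |Eser τ c - Eser τ' c| ≤ M * (Real.exp τ - Real.exp τ') := by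
  unfold Eser
  rw [← (Eser_summable τ hc).tsum_sub (Eser_summable τ' hc)]
  have hs : HasSum (fun k : ℕ => M * (τ ^ (k+1) / (Nat.factorial (k+1) : ℝ)
      - τ' ^ (k+1) / (Nat.factorial (k+1) : ℝ))) (M * (Real.exp τ - Real.exp τ')) := by
    have := ((hasSum_exp_sub τ).sub (hasSum_exp_sub τ')).mul_left M
    have e : M * (Real.exp τ - Real.exp τ') = M * (Real.exp τ - 1 - (Real.exp τ' - 1)) := by ring
    rw [e]; exact this
  rw [← Real.norm_eq_abs]
  refine tsum_of_norm_bounded hs fun k => ?_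
  rw [← sub_mul, norm_mul, Real.norm_eq_abs, Real.norm_eq_abs, mul_comm,
    abs_of_nonneg (a := _ - _)]
  · refine mul_le_mul_of_nonneg_right (hc k) ?_
    rw [← sub_div]
    exact div_nonneg (sub_nonneg.2 (pow_le_pow_left₀ h0 h _)) (by positivity)
  · rw [← sub_div]
    exact div_nonneg (sub_nonneg.2 (pow_le_pow_left₀ h0 h _)) (by positivity)

lemma Eser_le {τ : ℝ} (h0 : 0 ≤ τ) {c : ℕ → ℝ} {M : ℝ}
    (hc : ∀ k, |c k| ≤ M) : |Eser τ c| ≤ M * (Real.exp τ - 1) := by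
  simpa [Eser_zero] using Eser_sub_le le_rfl h0 hc

lemma Eser_diff {τ : ℝ} (h0 : 0 ≤ τ) {c c' : ℕ → ℝ} {M e : ℝ}
    (hc : ∀ k, |c k| ≤ M) (hc' : ∀ k, |c' k| ≤ M) (he : ∀ k, |c k - c' k| ≤ e) :
    |Eser τ c - Eser τ c'| ≤ e * (Real.exp τ - 1) := by
  have : Eser τ c - Eser τ c' = Eser τ (fun k => c k - c' k) := by
    unfold Eser
    rw [← (Eser_summable τ hc).tsum_sub (Eser_summable τ hc')]
    exact tsum_congr fun k => by ring
  rw [this]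
  exact Eser_le h0 he

lemma Eser_measurable {τ : ℝ → ℝ} (hτ : Measurable τ) {c : ℝ → ℕ → ℝ} {M : ℝ}
    (hc : ∀ s k, |c s k| ≤ M) (hm : ∀ k, Measurable (fun s => c s k)) :
    Measurable (fun s => Eser (τ s) (c s)) := by
  refine measurable_of_tendsto_metrizable
    (f := fun n s => ∑ k ∈ Finset.range n, τ s ^ (k+1) / (Nat.factorial (k+1) : ℝ) * c s k) ?_ ?_
  · intro n
    refine Finset.measurable_fun_sum _ fun k _ => ?_
    exact ((hτ.pow_const _).div_const _).mul (hm k)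
  · rw [tendsto_pi_nhds]
    intro s
    exact (Eser_summable (τ s) (hc s)).hasSum.tendsto_sum_nat

lemma gron {p : ℝ → ℝ} (hp : Continuous p) (hp0 : ∀ s, 0 ≤ p s) {δ K : ℝ} (hδ : 0 ≤ δ) (hK : 0 ≤ K)
    {T : ℝ} (hT : 0 ≤ T) (h : ∀ s ∈ Icc 0 T, p s ≤ δ + K * ∫ r in (0:ℝ)..s, p r) :
    p T ≤ δ * Real.exp (K * T) := by
  have hd : ∀ s, HasDerivAt (fun s => δ + K * ∫ r in (0:ℝ)..s, p r) (K * p s) s := fun s =>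
    ((intervalIntegral.integral_hasDerivAt_right (hp.intervalIntegrable _ _)
      hp.aestronglyMeasurable.stronglyMeasurableAtFilter hp.continuousAt).const_mul K).const_add δ
  have := norm_le_gronwallBound_of_norm_deriv_right_le (δ := δ) (K := K) (ε := 0) (a := 0) (b := T)
    (f := fun s => δ + K * ∫ r in (0:ℝ)..s, p r) (f' := fun s => K * p s)
    (fun s _ => (hd s).continuousAt.continuousWithinAt)
    (fun s _ => (hd s).hasDerivWithinAt) (by simp [abs_of_nonneg hδ])
    (fun s hs => by
      have h1 := h s ⟨hs.1, hs.2.le⟩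
      rw [add_zero, norm_mul, Real.norm_eq_abs, Real.norm_eq_abs, abs_of_nonneg hK,
        abs_of_nonneg (hp0 s)]
      exact mul_le_mul_of_nonneg_left (h1.trans (le_abs_self _)) hK) T ⟨hT, le_rfl⟩
  rw [gronwallBound_ε0, sub_zero] at this
  exact (h T ⟨hT, le_rfl⟩).trans ((le_abs_self _).trans this)

lemma fincover {Φ X : Type} [TopologicalSpace X] [CompactSpace X] (K : Φ → X → ℝ) (C : ℝ)
    (hC : ∀ φ x, |K φ x| ≤ C)
    (hK : ∀ x0, ∀ ε > 0, ∀ᶠ x in 𝓝 x0, ∀ φ, |K φ x - K φ x0| ≤ ε) {ε : ℝ} (hε : 0 < ε) :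
    ∃ (ι : Type) (_ : Finite ι) (c : Φ → ι), ∀ φ ψ, c φ = c ψ → ∀ x, |K φ x - K ψ x| ≤ 3 * ε := by
  obtain ⟨P, -, hP⟩ := isCompact_univ.elim_nhds_subcover
    (fun x0 => {x | ∀ φ, |K φ x - K φ x0| ≤ ε}) (fun x0 _ => hK x0 ε hε)
  let N : ℤ := ⌈C / ε⌉ + 1
  have hmem : ∀ φ x, ⌊K φ x / ε⌋ ∈ Set.Icc (-N) N := by
    intro φ x
    have h1 := abs_le.1 (hC φ x)
    have h2 : K φ x / ε ≤ C / ε := by gcongr; exact h1.2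
    have h3 : -(C / ε) ≤ K φ x / ε := by rw [← neg_div]; gcongr; exact h1.1
    have h4 := Int.le_ceil (C / ε)
    constructor
    · rw [Int.le_floor]; push_cast [N]; linarith
    · have : (⌊K φ x / ε⌋ : ℝ) ≤ (N : ℝ) := by
        push_cast [N]; linarith [Int.floor_le (K φ x / ε)]
      exact_mod_cast this
  refine ⟨P → Set.Icc (-N) N, inferInstance, fun φ q => ⟨⌊K φ q / ε⌋, hmem φ q⟩, ?_⟩
  intro φ ψ h x
  have hx := hP (mem_univ x)
  simp only [mem_iUnion] at hx
  obtain ⟨q, hq, hx⟩ := hx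
  have hx : ∀ φ, |K φ x - K φ q| ≤ ε := hx
  have e : ⌊K φ q / ε⌋ = ⌊K ψ q / ε⌋ := congrArg Subtype.val (congrFun h ⟨q, hq⟩)
  have h5 := Int.abs_sub_lt_one_of_floor_eq_floor e
  rw [← sub_div, abs_div, abs_of_pos hε, div_lt_one hε] at h5
  have a1 := abs_le.1 (hx φ)
  have a2 := abs_le.1 (hx ψ)
  have a3 := abs_lt.1 h5
  rw [abs_le]; constructor <;> linarith [a1.1, a1.2, a2.1, a2.2, a3.1, a3.2]

lemma kurat_le {X : Type*} [PseudoEMetricSpace X] {A : Set X} {ε : ℝ≥0∞} {ι : Type} [Finite ι]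
    (C : ι → Set X) (hA : A ⊆ ⋃ i, C i) (hd : ∀ i, EMetric.diam (C i) ≤ ε) : kurat A ≤ ε := by
  obtain ⟨n, ⟨e⟩⟩ := Finite.exists_equiv_fin ι
  refine sInf_le ⟨n, fun i => C (e.symm i), ?_, fun i => hd _⟩
  intro a ha
  obtain ⟨i, hi⟩ := mem_iUnion.1 (hA ha)
  exact mem_iUnion.2 ⟨e i, by simpa using hi⟩

noncomputable def Sop (J : ℝ → ℝ) (τ : ℝ) (h : ℝ → ℝ) (x : ℝ) : ℝ :=
  Eser τ (fun k => ak J (k+1) h x)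

noncomputable def KK (J : ℝ → ℝ) (g : ℝ → ℝ → ℝ) (φ : ℝ → ℝ) (t x : ℝ) : ℝ :=
  Sop J t φ x + ∫ s in (0:ℝ)..t, Real.exp s * Sop J (t - s) (g s) x

section
variable {J : ℝ → ℝ} (hJ0 : ∀ y, 0 ≤ J y) (hJi : Integrable J) (hJ1 : ∫ y, J y = 1)
include hJ0 hJi hJ1

lemma Tmap_eq {h : ℝ → ℝ} {M : ℝ} (hM : ∀ y, |h y| ≤ M) (τ x : ℝ) :
    Tmap J τ h x = Real.exp (-τ) * (h x + Sop J τ h x) := by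
  have h1 := Eser_summable τ (c := fun k => ak J (k+1) h x) (M := M)
    (fun k => ak_bound hJ0 hJi hJ1 hM (k+1) x)
  have h2 := ((summable_nat_add_iff
    (f := fun k : ℕ => τ ^ k / (Nat.factorial k : ℝ) * ak J k h x) 1).1 h1).tsum_eq_zero_add
  unfold Tmap Sop Eser
  rw [h2]
  simp [ak]

lemma Sop_bound {h : ℝ → ℝ} {M : ℝ} (hM : ∀ y, |h y| ≤ M) {τ : ℝ} (hτ : 0 ≤ τ) (x : ℝ) :
    |Sop J τ h x| ≤ M * (Real.exp τ - 1) :=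
  Eser_le hτ (fun k => ak_bound hJ0 hJi hJ1 hM (k+1) x)

lemma Sop_xdiff {h : ℝ → ℝ} {M : ℝ} (hM : ∀ y, |h y| ≤ M) (hc : Continuous h)
    {τ : ℝ} (hτ : 0 ≤ τ) (x x0 : ℝ) :
    |Sop J τ h x - Sop J τ h x0| ≤ M * om J x x0 * (Real.exp τ - 1) :=
  Eser_diff hτ (fun k => ak_bound hJ0 hJi hJ1 hM (k+1) x)
    (fun k => ak_bound hJ0 hJi hJ1 hM (k+1) x0)
    (fun k => ak_diff hJ0 hJi hJ1 hM hc k x x0)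

lemma Sop_cont {h : ℝ → ℝ} {M : ℝ} (hM : ∀ y, |h y| ≤ M) (hc : Continuous h)
    {τ : ℝ} (hτ : 0 ≤ τ) : Continuous (Sop J τ h) := by
  rw [continuous_iff_continuousAt]
  intro x0
  refine tendsto_iff_dist_tendsto_zero.2 ?_
  have h0 : Tendsto (fun x => M * om J x x0 * (Real.exp τ - 1)) (𝓝 x0) (𝓝 0) := by
    simpa using ((om_tendsto hJi x0).const_mul M).mul_const (Real.exp τ - 1)
  exact squeeze_zero (fun _ => dist_nonneg) (fun x => Sop_xdiff hJ0 hJi hJ1 hM hc hτ x x0) h0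

lemma Sop_tdiff {h : ℝ → ℝ} {M : ℝ} (hM : ∀ y, |h y| ≤ M) {τ τ' : ℝ} (hτ : 0 ≤ τ') (h' : τ' ≤ τ)
    (x : ℝ) : |Sop J τ h x - Sop J τ' h x| ≤ M * (Real.exp τ - Real.exp τ') :=
  Eser_sub_le hτ h' (fun k => ak_bound hJ0 hJi hJ1 hM (k+1) x)

variable {g : ℝ → ℝ → ℝ} {M : ℝ} (hM : ∀ s y, |g s y| ≤ M)
    (hg : ∀ s0, ∀ ε > 0, ∀ᶠ s in 𝓝 s0, ∀ y, |g s y - g s0 y| ≤ ε)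
include hM

lemma eS_bound {s t : ℝ} (hs : s ≤ t) (x : ℝ) :
    |Real.exp s * Sop J (t - s) (g s) x| ≤ M * (Real.exp t - Real.exp s) := by
  rw [abs_mul, abs_of_pos (Real.exp_pos _)]
  calc _ ≤ Real.exp s * (M * (Real.exp (t - s) - 1)) :=
        mul_le_mul_of_nonneg_left (Sop_bound hJ0 hJi hJ1 (hM s) (by linarith) x) (Real.exp_pos _).le
    _ = M * (Real.exp s * Real.exp (t - s) - Real.exp s) := by ring
    _ = _ := by rw [← Real.exp_add]; congr 3; ring

include hg

lemma eS_int {a b t : ℝ} (ha : 0 ≤ a) (hab : a ≤ b) (hb : b ≤ t) (x : ℝ) :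
    IntervalIntegrable (fun s => Real.exp s * Sop J (t - s) (g s) x) volume a b := by
  have hM0 : 0 ≤ M := (abs_nonneg _).trans (hM 0 0)
  rw [intervalIntegrable_iff_integrableOn_Ioc_of_le hab]
  have hm : Measurable (fun s => Real.exp s * Sop J (t - s) (g s) x) := by
    refine Real.measurable_exp.mul ?_
    refine Eser_measurable (by fun_prop) (M := M)
      (fun s k => ak_bound hJ0 hJi hJ1 (hM s) (k+1) x) (fun k => ?_)
    exact (ak_meas hJ0 hJi hJ1 hM hg k).comp (f := fun s : ℝ => (s, x)) (by fun_prop)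
  refine Measure.integrableOn_of_bounded (M := M * Real.exp t) (by simp) hm.aestronglyMeasurable ?_
  refine (ae_restrict_iff' measurableSet_Ioc).2 (Eventually.of_forall fun s hs => ?_)
  refine (eS_bound hJ0 hJi hJ1 hM (hs.2.trans hb) x).trans ?_
  exact mul_le_mul_of_nonneg_left (by linarith [Real.exp_pos s]) hM0

omit hJ0 hJi hJ1 hM in
lemma g_cont (x : ℝ) : Continuous (fun s => g s x) := by
  rw [continuous_iff_continuousAt]
  intro s0
  rw [ContinuousAt, Metric.tendsto_nhds]
  intro ε hε
  filter_upwards [hg s0 (ε/2) (by positivity)] with s hs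
  rw [Real.dist_eq]
  linarith [hs x]

lemma voc_eq {φ : ℝ → ℝ} (hφ : ∀ y, |φ y| ≤ M) {t x v : ℝ} (ht : 0 ≤ t)
    (hv : v = Tmap J t φ x + ∫ s in (0 : ℝ)..t, Tmap J (t - s) (g s) x) :
    Real.exp t * v = φ x + KK J g φ t x + ∫ s in (0:ℝ)..t, Real.exp s * g s x := by
  have e1 : (∫ s in (0 : ℝ)..t, Tmap J (t - s) (g s) x)
      = Real.exp (-t) * ((∫ s in (0:ℝ)..t, Real.exp s * g s x)
        + ∫ s in (0:ℝ)..t, Real.exp s * Sop J (t - s) (g s) x) := by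
    have hi : IntervalIntegrable (fun s => Real.exp s * g s x) volume 0 t :=
      (Real.continuous_exp.mul (g_cont hg x)).intervalIntegrable _ _
    rw [← intervalIntegral.integral_add hi
      (eS_int hJ0 hJi hJ1 hM hg le_rfl ht le_rfl x), ← intervalIntegral.integral_const_mul]
    refine intervalIntegral.integral_congr fun s _ => ?_
    rw [Tmap_eq hJ0 hJi hJ1 (hM s), show -(t - s) = -t + s by ring, Real.exp_add]
    ring
  rw [hv, e1, Tmap_eq hJ0 hJi hJ1 hφ]
  unfold KK
  have : Real.exp t * Real.exp (-t) = 1 := by rw [← Real.exp_add]; simp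
  linear_combination (φ x + Sop J t φ x + (∫ s in (0:ℝ)..t, Real.exp s * g s x)
        + ∫ s in (0:ℝ)..t, Real.exp s * Sop J (t - s) (g s) x) * this

omit hg in
lemma KK_bound {φ : ℝ → ℝ} (hφ : ∀ y, |φ y| ≤ M) {t : ℝ} (ht : 0 ≤ t) (x : ℝ) :
    |KK J g φ t x| ≤ (1 + t) * (M * Real.exp t) := by
  have hM0 : 0 ≤ M := (abs_nonneg _).trans (hM 0 0)
  have h1 := Sop_bound hJ0 hJi hJ1 hφ ht x
  have h2 : |∫ s in (0:ℝ)..t, Real.exp s * Sop J (t - s) (g s) x| ≤ M * Real.exp t * |t - 0| := by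
    rw [← Real.norm_eq_abs]
    refine intervalIntegral.norm_integral_le_of_norm_le_const fun s hs => ?_
    rw [uIoc_of_le ht] at hs
    refine (eS_bound hJ0 hJi hJ1 hM hs.2 x).trans ?_
    exact mul_le_mul_of_nonneg_left (by linarith [Real.exp_pos s]) hM0
  rw [sub_zero, abs_of_nonneg ht] at h2
  refine (abs_add_le _ _).trans ?_
  nlinarith

lemma KK_xdiff (hgc : ∀ s, Continuous (g s)) {φ : ℝ → ℝ} (hφ : ∀ y, |φ y| ≤ M) (hφc : Continuous φ)
    {t : ℝ} (ht : 0 ≤ t) (x x0 : ℝ) :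
    |KK J g φ t x - KK J g φ t x0| ≤ (1 + t) * (M * om J x x0 * Real.exp t) := by
  have hM0 : 0 ≤ M := (abs_nonneg _).trans (hM 0 0)
  have hmo : 0 ≤ M * om J x x0 := mul_nonneg hM0 (om_nonneg _ _ _)
  have h1 := Sop_xdiff hJ0 hJi hJ1 hφ hφc ht x x0
  have h2 : |(∫ s in (0:ℝ)..t, Real.exp s * Sop J (t - s) (g s) x)
      - ∫ s in (0:ℝ)..t, Real.exp s * Sop J (t - s) (g s) x0|
      ≤ M * om J x x0 * Real.exp t * |t - 0| := by
    rw [← Real.norm_eq_abs, ← intervalIntegral.integral_sub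
      (eS_int hJ0 hJi hJ1 hM hg le_rfl ht le_rfl x) (eS_int hJ0 hJi hJ1 hM hg le_rfl ht le_rfl x0)]
    refine intervalIntegral.norm_integral_le_of_norm_le_const fun s hs => ?_
    rw [uIoc_of_le ht] at hs
    rw [← mul_sub, Real.norm_eq_abs, abs_mul, abs_of_pos (Real.exp_pos _)]
    calc _ ≤ Real.exp s * (M * om J x x0 * (Real.exp (t - s) - 1)) :=
          mul_le_mul_of_nonneg_left (Sop_xdiff hJ0 hJi hJ1 (hM s) (hgc s) (by linarith [hs.2]) x x0)
            (Real.exp_pos _).le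
      _ = M * om J x x0 * (Real.exp s * Real.exp (t - s) - Real.exp s) := by ring
      _ = M * om J x x0 * (Real.exp t - Real.exp s) := by rw [← Real.exp_add]; congr 3; ring
      _ ≤ _ := mul_le_mul_of_nonneg_left (by linarith [Real.exp_pos s]) hmo
  rw [sub_zero, abs_of_nonneg ht] at h2
  unfold KK
  rw [add_sub_add_comm]
  refine (abs_add_le _ _).trans ?_
  nlinarith

lemma KK_tdiff {φ : ℝ → ℝ} (hφ : ∀ y, |φ y| ≤ M)
    {t t' : ℝ} (ht : 0 ≤ t') (h : t' ≤ t) (x : ℝ) :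
    |KK J g φ t x - KK J g φ t' x|
      ≤ (1 + t') * (M * (Real.exp t - Real.exp t')) + (t - t') * (M * Real.exp t) := by
  have hM0 : 0 ≤ M := (abs_nonneg _).trans (hM 0 0)
  have h1 := Sop_tdiff hJ0 hJi hJ1 hφ ht h x
  have h2 : |(∫ s in (0:ℝ)..t', Real.exp s * Sop J (t - s) (g s) x)
      - ∫ s in (0:ℝ)..t', Real.exp s * Sop J (t' - s) (g s) x|
      ≤ M * (Real.exp t - Real.exp t') * |t' - 0| := by
    rw [← Real.norm_eq_abs, ← intervalIntegral.integral_sub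
      (eS_int hJ0 hJi hJ1 hM hg le_rfl ht h x) (eS_int hJ0 hJi hJ1 hM hg le_rfl ht le_rfl x)]
    refine intervalIntegral.norm_integral_le_of_norm_le_const fun s hs => ?_
    rw [uIoc_of_le ht] at hs
    rw [← mul_sub, Real.norm_eq_abs, abs_mul, abs_of_pos (Real.exp_pos _)]
    calc _ ≤ Real.exp s * (M * (Real.exp (t - s) - Real.exp (t' - s))) :=
          mul_le_mul_of_nonneg_left (Sop_tdiff hJ0 hJi hJ1 (hM s) (by linarith [hs.2])
            (by linarith) x) (Real.exp_pos _).le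
      _ = M * (Real.exp s * Real.exp (t - s) - Real.exp s * Real.exp (t' - s)) := by ring
      _ = M * (Real.exp t - Real.exp t') := by
        rw [← Real.exp_add, ← Real.exp_add]; congr 3 <;> ring
  have h3 : |∫ s in t'..t, Real.exp s * Sop J (t - s) (g s) x| ≤ M * Real.exp t * |t - t'| := by
    rw [← Real.norm_eq_abs]
    refine intervalIntegral.norm_integral_le_of_norm_le_const fun s hs => ?_
    rw [uIoc_of_le h] at hs
    refine (eS_bound hJ0 hJi hJ1 hM hs.2 x).trans ?_
    exact mul_le_mul_of_nonneg_left (by linarith [Real.exp_pos s]) hM0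
  rw [sub_zero, abs_of_nonneg ht] at h2
  rw [abs_of_nonneg (sub_nonneg.2 h)] at h3
  unfold KK
  rw [← intervalIntegral.integral_add_adjacent_intervals
    (eS_int hJ0 hJi hJ1 hM hg le_rfl ht h x) (eS_int hJ0 hJi hJ1 hM hg ht h le_rfl x)]
  rw [abs_le] at *
  constructor <;> nlinarith

lemma KK_diff (hgc : ∀ s, Continuous (g s)) {φ : ℝ → ℝ} (hφ : ∀ y, |φ y| ≤ M) (hφc : Continuous φ)
    {T t t0 : ℝ} (ht : t ∈ Icc 0 T) (ht0 : t0 ∈ Icc 0 T) (x x0 : ℝ) :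
    |KK J g φ t x - KK J g φ t0 x0| ≤ (1 + T) * (M * om J x x0 * Real.exp T)
      + (1 + T) * (M * |Real.exp t - Real.exp t0|) + |t - t0| * (M * Real.exp T) := by
  have hM0 : 0 ≤ M := (abs_nonneg _).trans (hM 0 0)
  have hmo : 0 ≤ M * om J x x0 := mul_nonneg hM0 (om_nonneg _ _ _)
  have hT : Real.exp t ≤ Real.exp T := Real.exp_le_exp.2 ht.2
  have hT0 : Real.exp t0 ≤ Real.exp T := Real.exp_le_exp.2 ht0.2
  have h1 : |KK J g φ t x - KK J g φ t x0| ≤ (1 + T) * (M * om J x x0 * Real.exp T) := by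
    refine (KK_xdiff hJ0 hJi hJ1 hM hg hgc hφ hφc ht.1 x x0).trans ?_
    have h1 := ht.1
    have h2 := ht.2
    have h3 : 0 ≤ 1 + T := by linarith
    gcongr
  have h2 : |KK J g φ t x0 - KK J g φ t0 x0| ≤
      (1 + T) * (M * |Real.exp t - Real.exp t0|) + |t - t0| * (M * Real.exp T) := by
    have hTT : 0 ≤ T := ht.1.trans ht.2
    rcases le_total t0 t with h | h
    · refine (KK_tdiff hJ0 hJi hJ1 hM hg hφ ht0.1 h x0).trans ?_
      rw [abs_of_nonneg (sub_nonneg.2 (Real.exp_le_exp.2 h)), abs_of_nonneg (sub_nonneg.2 h)]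
      have e1 := sub_nonneg.2 (Real.exp_le_exp.2 h)
      have e2 := sub_nonneg.2 h
      have := ht0.2
      gcongr
    · rw [abs_sub_comm, abs_sub_comm (Real.exp t), abs_sub_comm t]
      refine (KK_tdiff hJ0 hJi hJ1 hM hg hφ ht.1 h x0).trans ?_
      rw [abs_of_nonneg (sub_nonneg.2 (Real.exp_le_exp.2 h)), abs_of_nonneg (sub_nonneg.2 h)]
      have e1 := sub_nonneg.2 (Real.exp_le_exp.2 h)
      have e2 := sub_nonneg.2 h
      have := ht.2
      gcongr
  have := abs_sub_le (KK J g φ t x) (KK J g φ t x0) (KK J g φ t0 x0)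
  linarith

omit hM hg in
lemma KK_zero {φ : ℝ → ℝ} (x : ℝ) : KK J g φ 0 x = 0 := by
  simp [KK, Sop, Eser_zero]

lemma g0_cont {φ : ℝ → ℝ} (hφ : ∀ y, |φ y| ≤ M) (hφc : Continuous φ)
    (v : ℝ → ℝ → ℝ) (hvc : ∀ t, 0 < t → Continuous (v t))
    (hv : ∀ t, 0 < t → ∀ x, Real.exp t * v t x =
      φ x + KK J g φ t x + ∫ s in (0:ℝ)..t, Real.exp s * g s x) : Continuous (g 0) := by
  have hM0 : 0 ≤ M := (abs_nonneg _).trans (hM 0 0)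
  refine continuous_of_uniform_approx_of_continuous fun U hU => ?_
  obtain ⟨ε, hε, hεU⟩ := Metric.mem_uniformity_dist.1 hU
  obtain ⟨δ, hδ, hδ'⟩ := Metric.eventually_nhds_iff.1 (hg 0 (ε/4) (by positivity))
  have hlim : Tendsto (fun t : ℝ => M * (Real.exp t - 1)) (𝓝[>] 0) (𝓝 0) := by
    have : Continuous (fun t : ℝ => M * (Real.exp t - 1)) := by fun_prop
    have h := this.tendsto 0
    simp only [Real.exp_zero, sub_self, mul_zero] at h
    exact h.mono_left nhdsWithin_le_nhds
  have e1 := hlim.eventually (gt_mem_nhds (show (0:ℝ) < ε/4 by positivity))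
  have e2 : ∀ᶠ t : ℝ in 𝓝[>] 0, t < δ := nhdsWithin_le_nhds (gt_mem_nhds hδ)
  obtain ⟨t, ⟨ht1, ht2⟩, ht⟩ := ((e1.and e2).and self_mem_nhdsWithin).exists
  have ht : 0 < t := ht
  refine ⟨fun x => (Real.exp t * v t x - φ x - Sop J t φ x) / t, ?_, fun x => hεU ?_⟩
  · exact (((continuous_const.mul (hvc t ht)).sub hφc).sub
      (Sop_cont hJ0 hJi hJ1 hφ hφc ht.le)).div_const t
  have hi : IntervalIntegrable (fun s => Real.exp s * g s x) volume 0 t :=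
    (Real.continuous_exp.mul (g_cont hg x)).intervalIntegrable _ _
  have hi2 := eS_int hJ0 hJi hJ1 hM hg le_rfl ht.le le_rfl x
  have e3 : Real.exp t * v t x - φ x - Sop J t φ x
      = ∫ s in (0:ℝ)..t, (Real.exp s * g s x + Real.exp s * Sop J (t - s) (g s) x) := by
    rw [intervalIntegral.integral_add hi hi2, hv t ht x]
    unfold KK; ring
  have e4 : |(∫ s in (0:ℝ)..t, (Real.exp s * g s x + Real.exp s * Sop J (t - s) (g s) x))
      - t * g 0 x| ≤ (3 * ε / 4) * |t - 0| := by
    have : t * g 0 x = ∫ s in (0:ℝ)..t, g 0 x := by simp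
    rw [this, ← intervalIntegral.integral_sub (hi.add hi2) (by simp), ← Real.norm_eq_abs]
    refine intervalIntegral.norm_integral_le_of_norm_le_const fun s hs => ?_
    rw [uIoc_of_le ht.le] at hs
    have a1 := eS_bound hJ0 hJi hJ1 hM hs.2 x
    have a2 := hδ' (y := s) (by rw [Real.dist_eq, sub_zero, abs_of_pos hs.1]; linarith [hs.2]) x
    have a3 : |(Real.exp s - 1) * g s x| ≤ M * (Real.exp t - 1) := by
      have : 1 ≤ Real.exp s := Real.one_le_exp hs.1.le
      have h' : Real.exp s ≤ Real.exp t := Real.exp_le_exp.2 hs.2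
      rw [abs_mul, abs_of_nonneg (by linarith), mul_comm]
      exact mul_le_mul (hM s x) (by linarith) (by linarith) hM0
    have a4 : M * (Real.exp t - Real.exp s) ≤ M * (Real.exp t - 1) :=
      mul_le_mul_of_nonneg_left (by linarith [Real.one_le_exp hs.1.le]) hM0
    rw [Real.norm_eq_abs]
    have : Real.exp s * g s x + Real.exp s * Sop J (t - s) (g s) x - g 0 x
      = (Real.exp s - 1) * g s x + Real.exp s * Sop J (t - s) (g s) x + (g s x - g 0 x) := by ring
    rw [this]
    have := abs_add_three ((Real.exp s - 1) * g s x) (Real.exp s * Sop J (t - s) (g s) x)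
      (g s x - g 0 x)
    linarith
  rw [dist_comm, Real.dist_eq]
  beta_reduce
  rw [e3]
  rw [sub_zero, abs_of_pos ht] at e4
  have e5 : (∫ s in (0:ℝ)..t, (Real.exp s * g s x + Real.exp s * Sop J (t - s) (g s) x)) / t - g 0 x
      = ((∫ s in (0:ℝ)..t, (Real.exp s * g s x + Real.exp s * Sop J (t - s) (g s) x))
      - t * g 0 x) / t := by field_simp
  rw [e5, abs_div, abs_of_pos ht, div_lt_iff₀ ht]
  nlinarith

lemma init_eq {φ : ℝ → ℝ} (hφ : ∀ y, |φ y| ≤ M)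
    (v : ℝ → ℝ → ℝ) (x : ℝ) (hvc : Continuous (fun s => v s x))
    (hv : ∀ t, 0 < t → Real.exp t * v t x =
      φ x + KK J g φ t x + ∫ s in (0:ℝ)..t, Real.exp s * g s x) : v 0 x = φ x := by
  have h1 : Tendsto (fun t => Real.exp t * v t x) (𝓝[>] 0) (𝓝 (v 0 x)) := by
    have := (Real.continuous_exp.mul hvc).tendsto 0
    simp only [Pi.mul_apply, Real.exp_zero, one_mul] at this
    exact this.mono_left nhdsWithin_le_nhds
  have h2 : Tendsto (fun t => KK J g φ t x) (𝓝[>] 0) (𝓝 0) := by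
    have hc : Continuous (fun t : ℝ => (1 + 0) * (M * (Real.exp t - Real.exp 0))
      + (t - 0) * (M * Real.exp t)) := by fun_prop
    have h := hc.tendsto 0
    simp only [sub_self, mul_zero, zero_mul, add_zero] at h
    refine squeeze_zero_norm' ?_ (h.mono_left nhdsWithin_le_nhds)
    filter_upwards [self_mem_nhdsWithin] with t ht
    have := KK_tdiff hJ0 hJi hJ1 hM hg hφ le_rfl (le_of_lt ht) x
    rw [KK_zero hJ0 hJi hJ1] at this
    simpa using this
  have h3 : Tendsto (fun t => ∫ s in (0:ℝ)..t, Real.exp s * g s x) (𝓝[>] 0) (𝓝 0) := by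
    have hc : Continuous (fun s => Real.exp s * g s x) := Real.continuous_exp.mul (g_cont hg x)
    have := (intervalIntegral.continuous_primitive (μ := volume) (fun a b => hc.intervalIntegrable a b) 0).tendsto 0
    rw [intervalIntegral.integral_same] at this
    exact this.mono_left nhdsWithin_le_nhds
  have h4 := (h2.const_add (φ x)).add h3
  simp only [add_zero] at h4
  refine tendsto_nhds_unique h1 (h4.congr' ?_)
  filter_upwards [self_mem_nhdsWithin] with t ht
  exact (hv t ht).symm

end
/-- Theorem 1: under the periodicity, steady-state and Lipschitz
assumptions on `f` and `β`, the solution semiflow `Q` of `u_t = J∗u − u + f(x,u)`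
(characterized by the variation-of-constants formula) satisfies
`α((Q(t)B)_I) ≤ e^{(k_f − 1)t} α(B_I)` for every nonempty bounded interval
`I = [a,b']`, every `t ≥ 0`, and every `B ⊆ C_β`. -/
theorem stmt_12 (J : ℝ → ℝ) (hJ0 : ∀ y, 0 ≤ J y) (hJi : Integrable J)
    (hJ1 : ∫ y, J y = 1)
    (f : ℝ → ℝ → ℝ) (L : ℝ) (hL : 0 < L)
    (hf0 : ∀ x, f x 0 = 0) (hfper : ∀ x u, f (x + L) u = f x u)
    (β : ℝ → ℝ) (hβc : Continuous β) (hβpos : ∀ x, 0 < β x)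
    (hβper : ∀ x, β (x + L) = β x)
    (hsteady : ∀ x, (∫ y, J (x - y) * β y) - β x + f x (β x) = 0)
    (kf : ℝ) (hkf : 0 < kf)
    (hlip : ∀ x ∈ Set.Icc 0 L, ∀ u₁ ∈ Set.Icc 0 (β x), ∀ u₂ ∈ Set.Icc 0 (β x),
      |f x u₁ - f x u₂| ≤ kf * |u₁ - u₂|)
    (Q : ℝ → (ℝ → ℝ) → (ℝ → ℝ))
    (hQmap : ∀ t : ℝ, 0 ≤ t → ∀ φ, memCbeta β φ → memCbeta β (Q t φ))
    (hQcont : ∀ φ, memCbeta β φ → ∀ t : ℝ, 0 ≤ t → ∀ ε > (0 : ℝ), ∃ δ > (0 : ℝ),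
      ∀ s : ℝ, 0 ≤ s → |s - t| < δ → ∀ x, |Q s φ x - Q t φ x| ≤ ε)
    (hVOC : ∀ φ, memCbeta β φ → ∀ t : ℝ, 0 < t → ∀ x,
      Q t φ x = Tmap J t φ x +
        ∫ s in (0 : ℝ)..t, Tmap J (t - s) (fun y => f y (Q s φ y)) x)
    (a b' : ℝ) (hab : a ≤ b') (t : ℝ) (ht : 0 ≤ t)
    (B : Set (ℝ → ℝ)) (hB : ∀ φ ∈ B, memCbeta β φ) :
    kurat (restrictSet a b' ((fun φ => Q t φ) '' B)) ≤
      ENNReal.ofReal (Real.exp ((kf - 1) * t)) * kurat (restrictSet a b' B) := by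
  classical
  -- periodicity
  have hF : Function.Periodic (fun x => (β x, f x)) L := fun x => by
    simp only [hβper x, Prod.mk.injEq, true_and]
    funext u; exact hfper x u
  have hred : ∀ x, ∃ y ∈ Set.Icc 0 L, β x = β y ∧ f x = f y := by
    intro x
    obtain ⟨y, hy, e⟩ := hF.exists_mem_Ico₀ hL x
    exact ⟨y, ⟨hy.1, hy.2.le⟩, congrArg Prod.fst e, congrArg Prod.snd e⟩
  have hlip' : ∀ x, ∀ u₁ ∈ Set.Icc 0 (β x), ∀ u₂ ∈ Set.Icc 0 (β x),
      |f x u₁ - f x u₂| ≤ kf * |u₁ - u₂| := by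
    intro x
    obtain ⟨y, hy, e1, e2⟩ := hred x
    rw [e1, e2]; exact hlip y hy
  obtain ⟨Mb, hMb'⟩ := isCompact_Icc.exists_bound_of_continuousOn (s := Set.Icc 0 L) hβc.continuousOn
  have hMb : ∀ x, β x ≤ Mb := by
    intro x
    obtain ⟨y, hy, e1, -⟩ := hred x
    rw [e1]; exact (le_abs_self _).trans (hMb' y hy)
  have hMb0 : 0 ≤ Mb := (hβpos 0).le.trans (hMb 0)
  obtain ⟨M, hMdef⟩ : ∃ M, M = (1 + kf) * Mb := ⟨_, rfl⟩
  have hM0 : 0 ≤ M := by rw [hMdef]; positivity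
  have hbd : ∀ φ, memCbeta β φ → ∀ y, |φ y| ≤ M := by
    intro φ hφ y
    rw [abs_of_nonneg (hφ.2 y).1, hMdef]
    have := (hφ.2 y).2.trans (hMb y)
    nlinarith [mul_nonneg hkf.le hMb0]
  have hfbd : ∀ φ, memCbeta β φ → ∀ y, |f y (φ y)| ≤ M := by
    intro φ hφ y
    have := hlip' y (φ y) (hφ.2 y) 0 ⟨le_rfl, (hβpos y).le⟩
    rw [hf0, sub_zero, sub_zero, abs_of_nonneg (hφ.2 y).1] at this
    have h2 := (hφ.2 y).2.trans (hMb y)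
    rw [hMdef]
    nlinarith [mul_le_mul_of_nonneg_left h2 hkf.le]
  -- clipped trajectories
  let u : (ℝ → ℝ) → ℝ → ℝ → ℝ := fun φ s => Q (max s 0) φ
  let g : (ℝ → ℝ) → ℝ → ℝ → ℝ := fun φ s y => f y (u φ s y)
  have hupos : ∀ φ s, 0 ≤ s → u φ s = Q s φ := fun φ s hs => by
    simp only [u, max_eq_left hs]
  have hu : ∀ φ, memCbeta β φ → ∀ s, memCbeta β (u φ s) := fun φ hφ s =>
    hQmap _ (le_max_right _ _) φ hφ
  have huc : ∀ φ, memCbeta β φ → ∀ s0, ∀ ε > 0, ∀ᶠ s in 𝓝 s0, ∀ y, |u φ s y - u φ s0 y| ≤ ε := by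
    intro φ hφ s0 ε hε
    obtain ⟨δ, hδ, h⟩ := hQcont φ hφ (max s0 0) (le_max_right _ _) ε hε
    refine Metric.eventually_nhds_iff.2 ⟨δ, hδ, fun s hs y => ?_⟩
    refine h (max s 0) (le_max_right _ _) (lt_of_le_of_lt ?_ hs) y
    rw [Real.dist_eq]
    exact abs_max_sub_max_le_abs s s0 0
  have hgM : ∀ φ, memCbeta β φ → ∀ s y, |g φ s y| ≤ M := fun φ hφ s y =>
    hfbd _ (hu φ hφ s) y
  have hgg : ∀ φ, memCbeta β φ → ∀ s0, ∀ ε > 0, ∀ᶠ s in 𝓝 s0, ∀ y, |g φ s y - g φ s0 y| ≤ ε := by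
    intro φ hφ s0 ε hε
    filter_upwards [huc φ hφ s0 (ε / kf) (by positivity)] with s hs y
    refine (hlip' y _ ((hu φ hφ s).2 y) _ ((hu φ hφ s0).2 y)).trans ?_
    have := mul_le_mul_of_nonneg_left (hs y) hkf.le
    rwa [mul_div_cancel₀ _ hkf.ne'] at this
  have hid : ∀ φ, memCbeta β φ → ∀ t, 0 < t → ∀ x, Real.exp t * u φ t x =
      φ x + KK J (g φ) φ t x + ∫ s in (0:ℝ)..t, Real.exp s * g φ s x := by
    intro φ hφ t ht x
    refine voc_eq hJ0 hJi hJ1 (hgM φ hφ) (hgg φ hφ) (hbd φ hφ) ht.le ?_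
    rw [hupos φ t ht.le, hVOC φ hφ t ht x]
    congr 1
    refine intervalIntegral.integral_congr fun s hs => ?_
    rw [uIcc_of_le ht.le] at hs
    simp only [g, hupos φ s hs.1]
  have hu0 : ∀ φ, memCbeta β φ → u φ 0 = φ := by
    intro φ hφ
    funext x
    exact init_eq hJ0 hJi hJ1 (hgM φ hφ) (hgg φ hφ) (hbd φ hφ) (u φ) x
      (g_cont (huc φ hφ) x) (fun t ht => hid φ hφ t ht x)
  have hfc : ∀ φ, memCbeta β φ → Continuous (fun y => f y (φ y)) := by
    intro φ hφ
    have := g0_cont hJ0 hJi hJ1 (hgM φ hφ) (hgg φ hφ) (hbd φ hφ) hφ.1 (u φ)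
      (fun t _ => (hu φ hφ t).1) (hid φ hφ)
    simpa only [g, hu0 φ hφ] using this
  have hgc : ∀ φ, memCbeta β φ → ∀ s, Continuous (g φ s) := fun φ hφ s => hfc _ (hu φ hφ s)
  have hid' : ∀ φ, memCbeta β φ → ∀ t, 0 ≤ t → ∀ x, Real.exp t * u φ t x =
      φ x + KK J (g φ) φ t x + ∫ s in (0:ℝ)..t, Real.exp s * g φ s x := by
    intro φ hφ t ht x
    rcases ht.eq_or_lt with h | h
    · subst h
      rw [hu0 φ hφ, KK_zero hJ0 hJi hJ1]; simp
    · exact hid φ hφ t h x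
  -- pairwise estimate
  have hpair : ∀ φ, memCbeta β φ → ∀ ψ, memCbeta β ψ → ∀ D ≥ 0, ∀ η ≥ 0, ∀ x,
      |φ x - ψ x| ≤ D → (∀ s ∈ Set.Icc 0 t, |KK J (g φ) φ s x - KK J (g ψ) ψ s x| ≤ η) →
      |Q t φ x - Q t ψ x| ≤ Real.exp ((kf - 1) * t) * (D + η) := by
    intro φ hφ ψ hψ D hD η hη x hx hK
    have c1 := g_cont (huc φ hφ) x
    have c2 := g_cont (huc ψ hψ) x
    have d1 := g_cont (hgg φ hφ) x
    have d2 := g_cont (hgg ψ hψ) x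
    have hpc : Continuous (fun s => Real.exp s * |u φ s x - u ψ s x|) :=
      Real.continuous_exp.mul (c1.sub c2).abs
    have := gron hpc (fun s => by positivity) (add_nonneg hD hη) hkf.le ht (by
      intro s hs
      have e1 : Real.exp s * |u φ s x - u ψ s x|
          = |Real.exp s * u φ s x - Real.exp s * u ψ s x| := by
        rw [← mul_sub, abs_mul, abs_of_pos (Real.exp_pos _)]
      rw [e1, hid' φ hφ s hs.1 x, hid' ψ hψ s hs.1 x]
      have i1 : IntervalIntegrable (fun s => Real.exp s * g φ s x) volume 0 s :=
        (Real.continuous_exp.mul d1).intervalIntegrable _ _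
      have i2 : IntervalIntegrable (fun s => Real.exp s * g ψ s x) volume 0 s :=
        (Real.continuous_exp.mul d2).intervalIntegrable _ _
      have h3 : |(∫ r in (0:ℝ)..s, Real.exp r * g φ r x) - ∫ r in (0:ℝ)..s, Real.exp r * g ψ r x|
          ≤ kf * ∫ r in (0:ℝ)..s, Real.exp r * |u φ r x - u ψ r x| := by
        rw [← intervalIntegral.integral_sub i1 i2, ← intervalIntegral.integral_const_mul,
          ← Real.norm_eq_abs]
        refine intervalIntegral.norm_integral_le_of_norm_le hs.1
          (Eventually.of_forall fun r _ => ?_) ((continuous_const.mul hpc).intervalIntegrable _ _)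
        rw [← mul_sub, Real.norm_eq_abs, abs_mul, abs_of_pos (Real.exp_pos _), mul_left_comm]
        exact mul_le_mul_of_nonneg_left
          (hlip' x _ ((hu φ hφ r).2 x) _ ((hu ψ hψ r).2 x)) (Real.exp_pos _).le
      have h4 := hK s hs
      refine le_trans ?_ (add_le_add (add_le_add hx h4) h3)
      refine le_trans (le_of_eq ?_) (abs_add_three _ _ _)
      congr 1; ring)
    simp only [hupos φ t ht, hupos ψ t ht] at this
    have e2 : Real.exp ((kf - 1) * t) = Real.exp (-t) * Real.exp (kf * t) := by
      rw [← Real.exp_add]; congr 1; ring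
    have e3 : Real.exp (-t) * Real.exp t = 1 := by rw [← Real.exp_add]; simp
    have := mul_le_mul_of_nonneg_left this (Real.exp_pos (-t)).le
    rw [← mul_assoc, e3, one_mul] at this
    rw [e2]; linarith
  -- colouring
  have hcol : ∀ η > 0, ∃ (ι : Type) (_ : Finite ι) (c : {φ // memCbeta β φ} → ι), ∀ φ ψ, c φ = c ψ →
      ∀ p : Set.Icc 0 t × Set.Icc a b',
        |KK J (g φ.1) φ.1 p.1 p.2 - KK J (g ψ.1) ψ.1 p.1 p.2| ≤ 3 * η := by
    intro η hη
    refine fincover (X := Set.Icc 0 t × Set.Icc a b')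
      (fun (φ : {φ // memCbeta β φ}) p => KK J (g φ.1) φ.1 p.1 p.2)
      ((1 + t) * (M * Real.exp t)) ?_ ?_ hη
    · intro φ p
      refine (KK_bound hJ0 hJi hJ1 (hgM φ.1 φ.2) (hbd φ.1 φ.2) p.1.2.1 p.2).trans ?_
      have h1 := p.1.2.1
      have h2 := p.1.2.2
      have h3 : 0 ≤ 1 + t := by linarith
      gcongr
    · intro p0 ε hε
      have hlim : Tendsto (fun p : Set.Icc 0 t × Set.Icc a b' =>
          (1 + t) * (M * om J p.2 p0.2 * Real.exp t)
          + (1 + t) * (M * |Real.exp p.1 - Real.exp p0.1|) + |(p.1 : ℝ) - p0.1| * (M * Real.exp t))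
          (𝓝 p0) (𝓝 0) := by
        have h1 : Tendsto (fun p : Set.Icc 0 t × Set.Icc a b' => om J p.2 p0.2) (𝓝 p0) (𝓝 0) :=
          (om_tendsto hJi p0.2).comp
            ((continuous_subtype_val.comp continuous_snd).tendsto p0)
        have h2 : Continuous (fun p : Set.Icc 0 t × Set.Icc a b' =>
          (1 + t) * (M * |Real.exp p.1 - Real.exp p0.1|)
            + |(p.1 : ℝ) - p0.1| * (M * Real.exp t)) := by fun_prop
        have h3 := (((h1.const_mul M).mul_const (Real.exp t)).const_mul (1 + t)).add (h2.tendsto p0)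
        simp only [sub_self, abs_zero, mul_zero, zero_mul, add_zero] at h3
        refine h3.congr fun p => ?_
        ring
      filter_upwards [hlim.eventually (gt_mem_nhds hε)] with p hp φ
      exact (KK_diff hJ0 hJi hJ1 (hgM φ.1 φ.2) (hgg φ.1 φ.2) (hgc φ.1 φ.2) (hbd φ.1 φ.2) φ.2.1
        p.1.2 p0.1.2 p.2 p0.2).trans hp.le
  -- conclusion
  have hc0 : ENNReal.ofReal (Real.exp ((kf - 1) * t)) ≠ 0 := by
    simp [Real.exp_pos]
  have hfin : ∀ e : ℝ≥0∞, (∃ (n : ℕ) (C : Fin n → Set C(Set.Icc a b', ℝ)),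
      restrictSet a b' B ⊆ ⋃ i, C i ∧ ∀ i, EMetric.diam (C i) ≤ e) →
      kurat (restrictSet a b' ((fun φ => Q t φ) '' B)) ≤
        ENNReal.ofReal (Real.exp ((kf - 1) * t)) * e := by
    rintro e ⟨n, C, hBC, hC⟩
    by_cases he : e = ⊤
    · rw [he, ENNReal.mul_top hc0]; exact le_top
    obtain ⟨D, hD, rfl⟩ : ∃ D : ℝ, 0 ≤ D ∧ e = ENNReal.ofReal D :=
      ⟨e.toReal, ENNReal.toReal_nonneg, (ENNReal.ofReal_toReal he).symm⟩
    have hlim : Tendsto (fun η : ℝ => ENNReal.ofReal (Real.exp ((kf - 1) * t) * (D + 3 * η)))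
        (𝓝[>] 0) (𝓝 (ENNReal.ofReal (Real.exp ((kf - 1) * t)) * ENNReal.ofReal D)) := by
      have hc : Continuous (fun η : ℝ =>
        ENNReal.ofReal (Real.exp ((kf - 1) * t) * (D + 3 * η))) :=
        ENNReal.continuous_ofReal.comp (by fun_prop)
      have := hc.tendsto 0
      simp only [mul_zero, add_zero] at this
      rw [← ENNReal.ofReal_mul (Real.exp_pos _).le]
      exact this.mono_left nhdsWithin_le_nhds
    refine ge_of_tendsto hlim ?_
    filter_upwards [self_mem_nhdsWithin] with η hη
    have hη : 0 < η := hη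
    obtain ⟨ι, hι, c, hcc⟩ := hcol η hη
    refine kurat_le (ι := Fin n × ι) (fun q => {ψ | ∃ (φ : ℝ → ℝ) (hφ : φ ∈ B),
      (∃ ψ0 ∈ C q.1, ∀ x, ψ0 x = φ x) ∧ c ⟨φ, hB φ hφ⟩ = q.2 ∧ ∀ x, ψ x = Q t φ x}) ?_ ?_
    · rintro ψ ⟨_, ⟨φ, hφ, rfl⟩, hψ⟩
      have hm : (⟨fun x => φ x, (hB φ hφ).1.comp continuous_subtype_val⟩ : C(Set.Icc a b', ℝ))
          ∈ restrictSet a b' B := ⟨φ, hφ, fun x => rfl⟩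
      obtain ⟨i, hi⟩ := mem_iUnion.1 (hBC hm)
      exact mem_iUnion.2 ⟨(i, c ⟨φ, hB φ hφ⟩), φ, hφ, ⟨_, hi, fun x => rfl⟩, rfl, hψ⟩
    · rintro ⟨i, κ⟩
      refine Metric.ediam_le ?_
      rintro ψ ⟨φ, hφ, ⟨ψ0, h0, h0'⟩, hκ, hψ⟩ ψ' ⟨φ', hφ', ⟨ψ0', h1, h1'⟩, hκ', hψ'⟩
      rw [edist_dist]
      refine ENNReal.ofReal_le_ofReal ?_
      have hdist : dist ψ0 ψ0' ≤ D := by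
        have h2 : edist ψ0 ψ0' ≤ ENNReal.ofReal D := (Metric.edist_le_ediam_of_mem h0 h1).trans (hC i)
        rw [edist_dist] at h2
        exact (ENNReal.ofReal_le_ofReal_iff hD).1 h2
      refine (ContinuousMap.dist_le (by positivity)).2 fun x => ?_
      rw [hψ, hψ', Real.dist_eq]
      refine hpair φ (hB φ hφ) φ' (hB φ' hφ') D hD (3 * η) (by positivity) x ?_ ?_
      · have := (ContinuousMap.dist_apply_le_dist (f := ψ0) (g := ψ0') x).trans hdist
        rwa [h0', h1', Real.dist_eq] at this
      · intro s hs
        exact hcc ⟨φ, hB φ hφ⟩ ⟨φ', hB φ' hφ'⟩ (hκ.trans hκ'.symm) (⟨s, hs⟩, x)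
  have : kurat (restrictSet a b' ((fun φ => Q t φ) '' B))
      / ENNReal.ofReal (Real.exp ((kf - 1) * t)) ≤ kurat (restrictSet a b' B) := by
    refine le_sInf fun e he => ?_
    rw [ENNReal.div_le_iff_le_mul (Or.inl hc0) (Or.inl ENNReal.ofReal_ne_top), mul_comm]
    exact hfin e he
  rwa [ENNReal.div_le_iff_le_mul (Or.inl hc0) (Or.inl ENNReal.ofReal_ne_top), mul_comm] at this
end
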